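/- arXiv:2410.09251 — 8 statements merged into one kernel-verified Lean document; each statement's English description precedes it below -/
import Mathlib

section
/- A Puiseux monoid satisfies the ascending chain condition on principal ideals (ACCP) if and only if it is strongly MCD. -/
/-- `c` divides `b` in the Puiseux monoid `M`, i.e., `b = c + d` for some `d ∈ M`. -/
def DvdIn (M : AddSubmonoid ℚ) (c b : ℚ) : Prop := ∃ d ∈ M, b = c + d

/-- `e` is an invertible element (unit) of the monoid `M`. -/
def IsUnitIn (M : AddSubmonoid ℚ) (e : ℚ) : Prop := e ∈ M ∧ ∃ f ∈ M, e + f = 0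

/-- `d` is a maximal common divisor of the subset `S` of `M`: `d ∈ M` is a common divisor
of `S` in `M`, and every common divisor in `M` of `{s - d : s ∈ S}` is a unit of `M`. -/
def IsMCDIn (M : AddSubmonoid ℚ) (d : ℚ) (S : Set ℚ) : Prop :=
  d ∈ M ∧ (∀ s ∈ S, DvdIn M d s) ∧
    ∀ e ∈ M, (∀ s ∈ S, DvdIn M e (s - d)) → IsUnitIn M e

/-- `M` is a strong MCD monoid: every nonempty subset of `M` has a maximal common divisor. -/
def StronglyMCDIn (M : AddSubmonoid ℚ) : Prop :=
  ∀ S : Set ℚ, S.Nonempty → S ⊆ (M : Set ℚ) → ∃ d, IsMCDIn M d S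

/-- The principal ideal `b + M` of `M`. -/
def PIdealIn (M : AddSubmonoid ℚ) (b : ℚ) : Set ℚ := {x | DvdIn M b x}

/-- `M` satisfies the ascending chain condition on principal ideals. -/
def ACCPIn (M : AddSubmonoid ℚ) : Prop :=
  ∀ b : ℕ → ℚ, (∀ n, b n ∈ M) →
    (∀ n, PIdealIn M (b n) ⊆ PIdealIn M (b (n + 1))) →
    ∃ N, ∀ n, N ≤ n → PIdealIn M (b n) = PIdealIn M (b N)

/-- `Thins e p q` holds if `q.1` is obtained from `p.1` by subtracting a finite sum of terms `e i`
with pairwise distinct indices `i` in `[p.2, q.2)`. -/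
def Thins (e : ℕ → ℚ) (p q : ℚ × ℕ) : Prop :=
  p.2 ≤ q.2 ∧ ∃ J : Finset ℕ, (∀ i ∈ J, p.2 ≤ i ∧ i < q.2) ∧ q.1 = p.1 - ∑ i ∈ J, e i

lemma Thins.refl (e : ℕ → ℚ) (p : ℚ × ℕ) : Thins e p p := ⟨le_rfl, ∅, by simp, by simp⟩

lemma Thins.trans {e : ℕ → ℚ} {p q r : ℚ × ℕ} (hpq : Thins e p q) (hqr : Thins e q r) :
    Thins e p r := by
  obtain ⟨h₁, J, hJ, hq⟩ := hpq
  obtain ⟨h₂, K, hK, hr⟩ := hqr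
  have hd : Disjoint J K := Finset.disjoint_left.2 fun i hi hi' =>
    absurd (hJ i hi).2 (not_lt.2 (hK i hi').1)
  refine ⟨h₁.trans h₂, J ∪ K, fun i hi => ?_, ?_⟩
  · rcases Finset.mem_union.1 hi with h | h
    · exact ⟨(hJ i h).1, (hJ i h).2.trans_le h₂⟩
    · exact ⟨h₁.trans (hK i h).1, (hK i h).2⟩
  · rw [Finset.sum_union hd, hr, hq]
    ring

lemma Thins.of_le {e : ℕ → ℚ} {p : ℕ → ℚ × ℕ} (h : ∀ n, Thins e (p n) (p (n + 1)))
    {m n : ℕ} (hmn : m ≤ n) : Thins e (p m) (p n) := by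
  induction n, hmn using Nat.le_induction with
  | base => exact Thins.refl e _
  | succ n _ ih => exact ih.trans (h n)

/-- Given `d`, a pair can be thinned either so that `d` no longer divides it, or so that some
nonzero term `e k` may be added to `d` while still dividing every further thinning. -/
lemma exists_thins (M : AddSubmonoid ℚ) (e : ℕ → ℚ) (he : ∀ N, ∃ k, N ≤ k ∧ e k ≠ 0)
    (d : ℚ) (p : ℚ × ℕ) :
    ∃ q, Thins e p q ∧
      (q.1 - d ∉ M ∨ ∃ k, e k ≠ 0 ∧ ∀ r, Thins e q r → r.1 - d - e k ∈ M) := by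
  by_cases h : ∃ q, Thins e p q ∧ q.1 - d ∉ M
  · obtain ⟨q, hpq, hq⟩ := h
    exact ⟨q, hpq, Or.inl hq⟩
  · push Not at h
    obtain ⟨k, hk, hek⟩ := he p.2
    refine ⟨(p.1, k + 1), ⟨by simp only; lia, ∅, by simp, by simp⟩,
      Or.inr ⟨k, hek, fun r hr => ?_⟩⟩
    have hpq : Thins e p (p.1 - e k, k + 1) :=
      ⟨by simp only; lia, {k}, by simp [hk], by simp⟩
    have hqr : Thins e (p.1 - e k, k + 1) (r.1 - e k, r.2) := by
      obtain ⟨h₁, J, hJ, hr⟩ := hr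
      exact ⟨h₁, J, hJ, by simp only [hr]; ring⟩
    have := h _ (hpq.trans hqr)
    rwa [show r.1 - d - e k = r.1 - e k - d by ring]

lemma accp_of_stronglyMCD (M : AddSubmonoid ℚ) (hM : ∀ x ∈ M, (0 : ℚ) ≤ x)
    (h : StronglyMCDIn M) : ACCPIn M := by
  intro b hb hasc
  by_contra! hns
  set e : ℕ → ℚ := fun n => b n - b (n + 1) with he_def
  have heM : ∀ n, e n ∈ M := fun n => by
    obtain ⟨c, hc, hbc⟩ : DvdIn M (b (n + 1)) (b n) := hasc n ⟨0, M.zero_mem, by simp⟩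
    simpa [he_def, hbc] using hc
  have hne : ∀ N, ∃ k, N ≤ k ∧ e k ≠ 0 := by
    intro N
    by_contra! hz
    obtain ⟨n, hn, hbn⟩ := hns N
    refine hbn (congrArg _ ?_)
    induction n, hn using Nat.le_induction with
    | base => rfl
    | succ n hn ih =>
      have hstep : b (n + 1) = b n := (sub_eq_zero.1 (hz n hn)).symm
      rw [hstep] at hbn ⊢
      exact ih hbn
  choose next hnext hdecide using exists_thins M e hne
  obtain ⟨d, hd⟩ := exists_surjective_nat ℚ
  let p : ℕ → ℚ × ℕ := fun n => Nat.rec (b 0, 0) (fun n q => next (d n) q) n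
  have hp : ∀ n, Thins e (p n) (p (n + 1)) := fun n => hnext (d n) (p n)
  have hpM : ∀ n, (p n).1 ∈ M := by
    intro n
    obtain ⟨-, J, hJ, hpn⟩ := Thins.of_le hp (Nat.zero_le n)
    have hsub : J ⊆ Finset.range (p n).2 := fun i hi => Finset.mem_range.2 (hJ i hi).2
    have hsum := Finset.sum_sdiff (f := e) hsub
    rw [Finset.sum_range_sub'] at hsum
    have : (p n).1 = b (p n).2 + ∑ i ∈ Finset.range (p n).2 \ J, e i := by
      rw [hpn]
      change b 0 - _ = _
      linarith
    rw [this]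
    exact M.add_mem (hb _) (M.sum_mem fun i _ => heM i)
  obtain ⟨x, -, hdvd, hmax⟩ := h (Set.range fun n => (p n).1) (Set.range_nonempty _)
    (Set.range_subset_iff.2 hpM)
  obtain ⟨n, rfl⟩ := hd x
  rcases hdecide (d n) (p n) with hn | ⟨k, hk, hkM⟩
  · obtain ⟨c, hc, hpc⟩ := hdvd _ ⟨n + 1, rfl⟩
    refine hn ?_
    change (p (n + 1)).1 - d n ∈ M
    simpa [hpc] using hc
  · have hlate : ∀ m, n + 1 ≤ m → (p m).1 - d n - e k ∈ M := fun m hm =>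
      hkM _ (Thins.of_le hp hm)
    have hall : ∀ m, (p m).1 - d n - e k ∈ M := by
      intro m
      obtain ⟨-, J, -, hJ⟩ := Thins.of_le hp (le_max_left m (n + 1))
      have := M.add_mem (hlate _ (le_max_right m (n + 1))) (M.sum_mem fun i (_ : i ∈ J) => heM i)
      rw [hJ] at this
      convert this using 1
      ring
    obtain ⟨-, f, hf, hef⟩ := hmax (e k) (heM k) (by
      rintro _ ⟨m, rfl⟩
      exact ⟨_, hall m, by ring⟩)
    have h₁ := hM _ (heM k)
    have h₂ := hM _ hf
    exact hk (by linarith)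

lemma stronglyMCD_of_accp (M : AddSubmonoid ℚ) (hM : ∀ x ∈ M, (0 : ℚ) ≤ x)
    (h : ACCPIn M) : StronglyMCDIn M := by
  intro S ⟨s, hs⟩ hSM
  by_contra! hno
  have hstep : ∀ x : {d // d ∈ M ∧ ∀ t ∈ S, DvdIn M d t},
      ∃ y : {d // d ∈ M ∧ ∀ t ∈ S, DvdIn M d t}, (y : ℚ) - x ∈ M ∧ (x : ℚ) < y := by
    rintro ⟨d, hd, hdS⟩
    have hnd := hno d
    unfold IsMCDIn at hnd
    push Not at hnd
    obtain ⟨e, he, heS, hu⟩ := hnd hd hdS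
    have hpos : 0 < e := (hM e he).lt_of_ne' fun h0 => hu ⟨he, 0, M.zero_mem, by simp [h0]⟩
    refine ⟨⟨d + e, M.add_mem hd he, fun t ht => ?_⟩, by simpa using he, by simpa using hpos⟩
    obtain ⟨c, hc, htc⟩ := heS t ht
    exact ⟨c, hc, by linarith⟩
  choose f hfM hflt using hstep
  let c : ℕ → {d // d ∈ M ∧ ∀ t ∈ S, DvdIn M d t} := fun n =>
    Nat.rec ⟨0, M.zero_mem, fun t ht => ⟨t, hSM ht, by simp⟩⟩ (fun _ x => f x) n
  obtain ⟨N, hN⟩ := h (fun n => s - (c n).1)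
    (fun n => by
      obtain ⟨g, hg, hsg⟩ := (c n).2.2 s hs
      have : s - (c n).1 = g := by linarith
      simpa only [this] using hg)
    (fun n x ⟨g, hg, hx⟩ =>
      ⟨_, M.add_mem (hfM (c n)) hg, by
        change x = s - (f (c n) : ℚ) + _
        rw [hx]
        ring⟩)
  have hmem : s - (c (N + 1)).1 ∈ PIdealIn M (s - (c N).1) := by
    rw [← hN (N + 1) (Nat.le_succ N)]
    exact ⟨0, M.zero_mem, by simp⟩
  obtain ⟨g, hg, hsg⟩ := hmem
  have h₁ := hM g hg
  have h₂ : (c N).1 < (c (N + 1)).1 := hflt (c N)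
  linarith

/-- A Puiseux monoid (an additive submonoid of `ℚ≥0`) satisfies the ACCP if and only if
it is strongly MCD. -/
theorem puiseux_accp_iff_stronglyMCD (M : AddSubmonoid ℚ)
    (hM : ∀ x ∈ M, (0 : ℚ) ≤ x) : ACCPIn M ↔ StronglyMCDIn M := by
  exact ⟨stronglyMCD_of_accp M hM, accp_of_stronglyMCD M hM⟩
end

section
/- Let p_n denote the n-th odd prime, and let M be the Puiseux monoid generated by the set {1/(2^{n-1} p_n) : n ∈ ℕ} (Grams' monoid). Then M is atomic and its set of atoms is exactly {1/(2^{n-1} p_n) : n ∈ ℕ}. -/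
/-- `a` is an atom (irreducible element) of `M`: a non-invertible element of `M` such that
whenever `a = b + c` with `b, c ∈ M`, either `b` or `c` is invertible in `M`. -/
def IsAtomIn (M : AddSubmonoid ℚ) (a : ℚ) : Prop :=
  a ∈ M ∧ ¬ IsUnitIn M a ∧
    ∀ b ∈ M, ∀ c ∈ M, a = b + c → IsUnitIn M b ∨ IsUnitIn M c

/-- `M` is atomic: every non-invertible element of `M` is a finite sum of atoms of `M`. -/
def AtomicIn (M : AddSubmonoid ℚ) : Prop :=
  ∀ x ∈ M, ¬ IsUnitIn M x →
    ∃ (k : ℕ) (f : Fin k → ℚ), (∀ i, IsAtomIn M (f i)) ∧ x = ∑ i, f i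

theorem isUnitIn_iff_eq_zero {M : AddSubmonoid ℚ} (hM : ∀ x ∈ M, 0 ≤ x) {e : ℚ} :
    IsUnitIn M e ↔ e = 0 := by
  constructor
  · rintro ⟨he, f, hf, hef⟩
    linarith [hM e he, hM f hf]
  · rintro rfl
    exact ⟨M.zero_mem, 0, M.zero_mem, add_zero 0⟩

theorem nonneg_of_mem_closure {S : Set ℚ} (hS : ∀ s ∈ S, 0 < s) {x : ℚ}
    (hx : x ∈ AddSubmonoid.closure S) : 0 ≤ x := by
  induction hx using AddSubmonoid.closure_induction with
  | mem s hs => exact (hS s hs).le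
  | zero => exact le_rfl
  | add y z _ _ hy hz => exact add_nonneg hy hz

/-- An element of the monoid generated by `S` either is divisible by `a`, or has denominator
prime to `p`, when `p` divides the denominator of no generator other than `a`. -/
theorem dvdIn_or_not_dvd_den {S : Set ℚ} {a : ℚ} {p : ℕ} (hp : p.Prime)
    (h : ∀ s ∈ S, s ≠ a → ¬ p ∣ s.den) {x : ℚ} (hx : x ∈ AddSubmonoid.closure S) :
    DvdIn (AddSubmonoid.closure S) a x ∨ ¬ p ∣ x.den := by
  induction hx using AddSubmonoid.closure_induction with
  | mem s hs =>
    by_cases hsa : s = a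
    · exact .inl ⟨0, zero_mem _, by rw [hsa, add_zero]⟩
    · exact .inr (h s hs hsa)
  | zero => exact .inr (by simpa using hp.one_lt.ne')
  | add y z hy hz ihy ihz =>
    rcases ihy with ⟨d, hd, rfl⟩ | hy'
    · exact .inl ⟨d + z, add_mem hd hz, add_assoc _ _ _⟩
    rcases ihz with ⟨d, hd, rfl⟩ | hz'
    · exact .inl ⟨y + d, add_mem hy hd, add_left_comm _ _ _⟩
    refine .inr fun hdvd => ?_
    rcases hp.dvd_mul.1 (hdvd.trans (Rat.add_den_dvd y z)) with h' | h'
    exacts [hy' h', hz' h']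

theorem isAtomIn_of_prime_dvd_den {S : Set ℚ} (hS : ∀ s ∈ S, 0 < s) {a : ℚ} (ha : a ∈ S)
    {p : ℕ} (hp : p.Prime) (hpa : p ∣ a.den) (h : ∀ s ∈ S, s ≠ a → ¬ p ∣ s.den) :
    IsAtomIn (AddSubmonoid.closure S) a := by
  have hM : ∀ x ∈ AddSubmonoid.closure S, 0 ≤ x := fun x hx => nonneg_of_mem_closure hS hx
  refine ⟨AddSubmonoid.subset_closure ha, ?_, fun b hb c hc habc => ?_⟩
  · rw [isUnitIn_iff_eq_zero hM]
    exact (hS a ha).ne'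
  rw [isUnitIn_iff_eq_zero hM, isUnitIn_iff_eq_zero hM]
  rcases dvdIn_or_not_dvd_den hp h hb with ⟨d, hd, hbd⟩ | hb'
  · right
    linarith [hM d hd, hM c hc]
  rcases dvdIn_or_not_dvd_den hp h hc with ⟨d, hd, hcd⟩ | hc'
  · left
    linarith [hM d hd, hM b hb]
  rw [habc] at hpa
  rcases hp.dvd_mul.1 (hpa.trans (Rat.add_den_dvd b c)) with h' | h'
  exacts [absurd h' hb', absurd h' hc']

theorem mem_of_isAtomIn_closure {S : Set ℚ} (hS : ∀ s ∈ S, 0 < s) {a : ℚ}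
    (ha : IsAtomIn (AddSubmonoid.closure S) a) : a ∈ S := by
  have hM : ∀ x ∈ AddSubmonoid.closure S, 0 ≤ x := fun x hx => nonneg_of_mem_closure hS hx
  obtain ⟨haM, hau, hirr⟩ := ha
  simp only [isUnitIn_iff_eq_zero hM] at hau hirr
  obtain ⟨l, hl, rfl⟩ := AddSubmonoid.exists_list_of_mem_closure haM
  cases l with
  | nil => simp at hau
  | cons s t =>
    rw [List.forall_mem_cons] at hl
    have ht : t.sum ∈ AddSubmonoid.closure S :=
      AddSubmonoid.list_sum_mem _ fun y hy => AddSubmonoid.subset_closure (hl.2 y hy)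
    rcases hirr s (AddSubmonoid.subset_closure hl.1) t.sum ht List.sum_cons with h0 | h0
    · exact absurd h0 (hS s hl.1).ne'
    · rw [List.sum_cons, h0, add_zero]
      exact hl.1

theorem atomicIn_closure {S : Set ℚ} (h : ∀ s ∈ S, IsAtomIn (AddSubmonoid.closure S) s) :
    AtomicIn (AddSubmonoid.closure S) := by
  intro x hx _
  obtain ⟨l, hl, rfl⟩ := AddSubmonoid.exists_list_of_mem_closure hx
  exact ⟨l.length, l.get, fun i => h _ (hl _ (l.get_mem i)), by
    rw [← List.sum_ofFn, List.ofFn_get]⟩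

theorem den_one_div_two_pow_mul_nth_prime (n : ℕ) :
    (1 / (2 ^ (n - 1) * (Nat.nth Nat.Prime n : ℚ))).den
      = 2 ^ (n - 1) * Nat.nth Nat.Prime n := by
  have hpos : 2 ^ (n - 1) * Nat.nth Nat.Prime n ≠ 0 :=
    mul_ne_zero (by positivity) (Nat.prime_nth_prime n).ne_zero
  rw [one_div, ← Nat.cast_ofNat, ← Nat.cast_pow, ← Nat.cast_mul, Rat.inv_natCast_den,
    if_neg hpos]

theorem not_nth_prime_dvd_two_pow_mul {n m k : ℕ} (hn : 1 ≤ n) (hmn : m ≠ n) :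
    ¬ Nat.nth Nat.Prime n ∣ 2 ^ k * Nat.nth Nat.Prime m := by
  have hp := Nat.prime_nth_prime n
  have hinj := Nat.nth_injective Nat.infinite_setOfPred_prime
  intro hdvd
  rcases hp.dvd_mul.1 hdvd with h2 | hm
  · have h := (Nat.prime_dvd_prime_iff_eq hp Nat.prime_two).1 (hp.dvd_of_dvd_pow h2)
    rw [← Nat.nth_prime_zero_eq_two] at h
    have := hinj h
    omega
  · exact hmn (hinj ((Nat.prime_dvd_prime_iff_eq hp (Nat.prime_nth_prime m)).1 hm)).symm

/-- Grams' monoid, the Puiseux monoid generated by `{1/(2^(n-1) pₙ) : n ∈ ℕ}` where `pₙ`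
is the `n`-th odd prime (so `pₙ = Nat.nth Nat.Prime n` for `n ≥ 1`), is atomic, and its
set of atoms is exactly the set of defining generators. -/
theorem grams_monoid_atomic (M : AddSubmonoid ℚ)
    (hM : M = AddSubmonoid.closure
      {q : ℚ | ∃ n : ℕ, 1 ≤ n ∧ q = 1 / (2 ^ (n - 1) * (Nat.nth Nat.Prime n : ℚ))}) :
    AtomicIn M ∧
      {a : ℚ | IsAtomIn M a} =
        {q : ℚ | ∃ n : ℕ, 1 ≤ n ∧ q = 1 / (2 ^ (n - 1) * (Nat.nth Nat.Prime n : ℚ))} := by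
  subst hM
  set S := {q : ℚ | ∃ n : ℕ, 1 ≤ n ∧ q = 1 / (2 ^ (n - 1) * (Nat.nth Nat.Prime n : ℚ))}
  have hS : ∀ s ∈ S, 0 < s := by
    rintro _ ⟨n, -, rfl⟩
    have : (0 : ℚ) < Nat.nth Nat.Prime n := by exact_mod_cast (Nat.prime_nth_prime n).pos
    positivity
  have hatom : ∀ s ∈ S, IsAtomIn (AddSubmonoid.closure S) s := by
    rintro _ ⟨n, hn, rfl⟩
    refine isAtomIn_of_prime_dvd_den hS ⟨n, hn, rfl⟩ (Nat.prime_nth_prime n) ?_ ?_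
    · rw [den_one_div_two_pow_mul_nth_prime]
      exact Nat.dvd_mul_left _ _
    · rintro _ ⟨m, -, rfl⟩ hne
      rw [den_one_div_two_pow_mul_nth_prime]
      refine not_nth_prime_dvd_two_pow_mul hn ?_
      rintro rfl
      exact hne rfl
  exact ⟨atomicIn_closure hatom,
    Set.Subset.antisymm (fun _ ha => mem_of_isAtomIn_closure hS ha) hatom⟩
end

section
/- Let p_n denote the n-th odd prime, and let M be the Puiseux monoid generated by the set {1/(2^{n-1} p_n) : n ∈ ℕ} (Grams' monoid). Then M does not satisfy the ascending chain condition on principal ideals (ACCP); in particular, the ascending chain of principal ideals (1/2^n + M)_{n ≥ 1} does not stabilize. -/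
theorem one_div_two_pow_mem_grams (k : ℕ) :
    (1 / 2 ^ k : ℚ) ∈ AddSubmonoid.closure
      {q : ℚ | ∃ n : ℕ, 1 ≤ n ∧ q = 1 / (2 ^ (n - 1) * (Nat.nth Nat.Prime n : ℚ))} := by
  have hp : (Nat.nth Nat.Prime (k + 1) : ℚ) ≠ 0 :=
    Nat.cast_ne_zero.mpr (Nat.prime_nth_prime (k + 1)).ne_zero
  have h : (1 / 2 ^ k : ℚ) = Nat.nth Nat.Prime (k + 1) •
      (1 / (2 ^ k * (Nat.nth Nat.Prime (k + 1) : ℚ))) := by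
    rw [nsmul_eq_mul]
    field_simp
  rw [h]
  refine nsmul_mem (AddSubmonoid.mem_closure_of_mem ?_) _
  exact ⟨k + 1, by omega, by simp⟩

theorem nonneg_of_mem_grams {x : ℚ}
    (hx : x ∈ AddSubmonoid.closure
      {q : ℚ | ∃ n : ℕ, 1 ≤ n ∧ q = 1 / (2 ^ (n - 1) * (Nat.nth Nat.Prime n : ℚ))}) :
    0 ≤ x := by
  induction hx using AddSubmonoid.closure_induction with
  | mem x hx =>
    obtain ⟨n, -, rfl⟩ := hx
    positivity
  | zero => exact le_rfl
  | add x y _ _ hx hy => exact add_nonneg hx hy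

theorem PIdealIn_subset_of_dvdIn {M : AddSubmonoid ℚ} {b c : ℚ} (h : DvdIn M c b) :
    PIdealIn M b ⊆ PIdealIn M c := by
  rintro x ⟨e, he, rfl⟩
  obtain ⟨d, hd, rfl⟩ := h
  exact ⟨d + e, add_mem hd he, add_assoc c d e⟩

/-- Grams' monoid `M` (generated by `{1/(2^(n-1) pₙ) : n ≥ 1}` with `pₙ` the `n`-th odd
prime) does not satisfy the ACCP; in particular, `1/2^n ∈ M` for every `n ≥ 1` and the
ascending chain of principal ideals `(1/2^n + M)_{n ≥ 1}` does not stabilize. -/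
theorem grams_monoid_not_accp (M : AddSubmonoid ℚ)
    (hM : M = AddSubmonoid.closure
      {q : ℚ | ∃ n : ℕ, 1 ≤ n ∧ q = 1 / (2 ^ (n - 1) * (Nat.nth Nat.Prime n : ℚ))}) :
    ¬ ACCPIn M ∧
      (∀ n : ℕ, (1 / 2 ^ (n + 1) : ℚ) ∈ M) ∧
      (∀ n : ℕ, PIdealIn M ((1 : ℚ) / 2 ^ (n + 1)) ⊆ PIdealIn M ((1 : ℚ) / 2 ^ (n + 2))) ∧
      ¬ ∃ N : ℕ, ∀ n : ℕ, N ≤ n →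
        PIdealIn M ((1 : ℚ) / 2 ^ (n + 1)) = PIdealIn M ((1 : ℚ) / 2 ^ (N + 1)) := by
  subst hM
  have hmem := fun n : ℕ => one_div_two_pow_mem_grams (n + 1)
  have hchain := fun n : ℕ => PIdealIn_subset_of_dvdIn (b := (1 : ℚ) / 2 ^ (n + 1))
    (c := 1 / 2 ^ (n + 2)) ⟨1 / 2 ^ (n + 2), hmem (n + 1), by field_simp; ring⟩
  suffices hstab : ¬ ∃ N : ℕ, ∀ n : ℕ, N ≤ n → PIdealIn _ ((1 : ℚ) / 2 ^ (n + 1)) =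
      PIdealIn _ ((1 : ℚ) / 2 ^ (N + 1)) from
    ⟨fun h => hstab (h (fun n => 1 / 2 ^ (n + 1)) hmem hchain), hmem, hchain, hstab⟩
  rintro ⟨N, hN⟩
  have hself := (hN (N + 1) (Nat.le_succ N)).subset
    (show DvdIn _ (1 / 2 ^ (N + 2)) (1 / 2 ^ (N + 2)) from ⟨0, zero_mem _, (add_zero _).symm⟩)
  obtain ⟨d, hd, hdeq⟩ := hself
  have hlt : (1 : ℚ) / 2 ^ (N + 2) < 1 / 2 ^ (N + 1) :=
    one_div_pow_lt_one_div_pow_of_lt one_lt_two (Nat.lt_succ_self (N + 1))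
  linarith [nonneg_of_mem_grams hd]
end

section
/- Let (d_n)_{n ≥ 1} be a strictly increasing sequence of positive integers and (p_n)_{n ≥ 1} a sequence of pairwise distinct primes such that p_n does not divide d_m for any m, n ∈ ℕ. Let M be the Puiseux monoid generated by {1/(d_n p_n) : n ∈ ℕ} and N the Puiseux monoid generated by {1/d_n : n ∈ ℕ}. Then every q ∈ M can be written uniquely as q = c_0 + Σ_{n ∈ ℕ} c_n · 1/(d_n p_n), where c_0 ∈ N and (c_n)_{n ≥ 1} is a sequence of nonnegative integers with c_n ∈ {0, 1, ..., p_n − 1} for every n ∈ ℕ and with only finitely many nonzero terms. -/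
/-- `(c₀, c)` is a canonical sum decomposition of `q`: `q = c₀ + Σₙ cₙ · 1/(dₙ pₙ)` with
`c₀ ∈ N`, each `cₙ ∈ {0, 1, ..., pₙ - 1}`, and only finitely many `cₙ` nonzero. -/
def IsCanonDecomp (d p : ℕ → ℕ) (N : AddSubmonoid ℚ) (q c0 : ℚ) (c : ℕ → ℕ) : Prop :=
  c0 ∈ N ∧ (∀ n, c n < p n) ∧ {n | c n ≠ 0}.Finite ∧
    q = c0 + ∑ᶠ n : ℕ, (c n : ℚ) * (1 / ((d n : ℚ) * (p n : ℚ)))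

/-- The additive group of rational numbers that are integral at the prime `p`. -/
def padicIntegralRat (p : ℕ) [Fact p.Prime] : AddSubgroup ℚ where
  carrier := {x | padicNorm p x ≤ 1}
  zero_mem' := by simp
  add_mem' := fun {_ _} ha hb => padicNorm.nonarchimedean.trans (max_le ha hb)
  neg_mem' := fun {x} hx => by simpa using hx

theorem mem_padicIntegralRat {p : ℕ} [Fact p.Prime] {x : ℚ} :
    x ∈ padicIntegralRat p ↔ padicNorm p x ≤ 1 := Iff.rfl

theorem one_div_natCast_mem_padicIntegralRat {p : ℕ} [Fact p.Prime] {m : ℕ} (h : ¬ p ∣ m) :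
    1 / (m : ℚ) ∈ padicIntegralRat p := by
  rw [mem_padicIntegralRat, padicNorm.div, padicNorm.nat_eq_one_iff m |>.2 h]
  simp

theorem natCast_mul_mem_padicIntegralRat {p : ℕ} [Fact p.Prime] {x : ℚ}
    (hx : x ∈ padicIntegralRat p) (k : ℕ) : (k : ℚ) * x ∈ padicIntegralRat p := by
  simpa using nsmul_mem hx k

theorem dvd_of_mul_one_div_mem_padicIntegralRat {p : ℕ} [Fact p.Prime] {a : ℤ} {m : ℕ}
    (hm : ¬ p ∣ m) (h : (a : ℚ) * (1 / ((m : ℚ) * (p : ℚ))) ∈ padicIntegralRat p) :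
    (p : ℤ) ∣ a := by
  have hp : p.Prime := Fact.out
  have hnorm := mem_padicIntegralRat.1 h
  rw [padicNorm.mul, padicNorm.div, padicNorm.mul, padicNorm.nat_eq_one_iff m |>.2 hm,
    padicNorm.padicNorm_p hp.one_lt, padicNorm.one, one_mul, one_div, inv_inv] at hnorm
  rw [← padicNorm.int_lt_one_iff]
  have hp1 : (1 : ℚ) < p := by exact_mod_cast hp.one_lt
  nlinarith [padicNorm.nonneg (p := p) (a : ℚ)]

theorem exists_finsupp_of_mem_closure {g : ℕ → ℚ} {q : ℚ}
    (hq : q ∈ AddSubmonoid.closure {x : ℚ | ∃ n, x = g n}) :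
    ∃ f : ℕ →₀ ℕ, q = f.sum fun n k => (k : ℚ) * g n := by
  induction hq using AddSubmonoid.closure_induction with
  | mem x hx =>
    obtain ⟨n, rfl⟩ := hx
    exact ⟨Finsupp.single n 1, by simp⟩
  | zero => exact ⟨0, by simp⟩
  | add x y _ _ hx hy =>
    obtain ⟨f, rfl⟩ := hx
    obtain ⟨e, rfl⟩ := hy
    refine ⟨f + e, ?_⟩
    rw [Finsupp.sum_add_index'] <;> intros <;> push_cast <;> ring

theorem exists_isCanonDecomp {d p : ℕ → ℕ} (hp : ∀ n, 0 < p n) {q : ℚ}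
    (hq : q ∈ AddSubmonoid.closure {q : ℚ | ∃ n : ℕ, q = 1 / ((d n : ℚ) * (p n : ℚ))}) :
    ∃ (c0 : ℚ) (c : ℕ → ℕ),
      IsCanonDecomp d p (AddSubmonoid.closure {q : ℚ | ∃ n : ℕ, q = 1 / (d n : ℚ)}) q c0 c := by
  obtain ⟨f, rfl⟩ := exists_finsupp_of_mem_closure hq
  have hsub : {n | f n % p n ≠ 0} ⊆ (f.support : Set ℕ) := by
    intro n hn
    rw [Finset.mem_coe, Finsupp.mem_support_iff]
    intro h
    simp [h] at hn
  refine ⟨∑ n ∈ f.support, ((f n / p n : ℕ) : ℚ) * (1 / (d n : ℚ)), fun n => f n % p n,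
    sum_mem fun n _ => ?_, fun n => Nat.mod_lt _ (hp n),
    f.support.finite_toSet.subset hsub, ?_⟩
  · rw [← nsmul_eq_mul]
    refine nsmul_mem (AddSubmonoid.subset_closure ?_) _
    exact ⟨n, rfl⟩
  · rw [finsum_eq_sum_of_support_subset (s := f.support), ← Finset.sum_add_distrib, Finsupp.sum]
    · refine Finset.sum_congr rfl fun n _ => ?_
      have hpn : (p n : ℚ) ≠ 0 := by exact_mod_cast (hp n).ne'
      have hdiv : (f n : ℚ) = p n * (f n / p n : ℕ) + (f n % p n : ℕ) := by
        exact_mod_cast (Nat.div_add_mod (f n) (p n)).symm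
      rw [hdiv, one_div, one_div, mul_inv]
      field_simp
    · intro n hn
      refine hsub fun h => hn ?_
      simp [h]

theorem IsCanonDecomp.unique {d p : ℕ → ℕ} (hp : ∀ n, (p n).Prime)
    (hpinj : Function.Injective p) (hpd : ∀ m n, ¬ p n ∣ d m) {q a b : ℚ} {c c' : ℕ → ℕ}
    (h : IsCanonDecomp d p (AddSubmonoid.closure {q : ℚ | ∃ n : ℕ, q = 1 / (d n : ℚ)}) q a c)
    (h' : IsCanonDecomp d p (AddSubmonoid.closure {q : ℚ | ∃ n : ℕ, q = 1 / (d n : ℚ)}) q b c') :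
    a = b ∧ c = c' := by
  obtain ⟨ha, hc, hfin, hq⟩ := h
  obtain ⟨hb, hc', hfin', hq'⟩ := h'
  suffices hcc : c = c' by
    subst hcc
    exact ⟨add_right_cancel (hq.symm.trans hq'), rfl⟩
  funext k
  have : Fact (p k).Prime := ⟨hp k⟩
  have hN : ∀ x ∈ AddSubmonoid.closure {q : ℚ | ∃ n : ℕ, q = 1 / (d n : ℚ)},
      x ∈ padicIntegralRat (p k) := by
    intro x hx
    refine (AddSubmonoid.closure_le (S := (padicIntegralRat (p k)).toAddSubmonoid)).2 ?_ hx
    rintro _ ⟨n, rfl⟩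
    exact one_div_natCast_mem_padicIntegralRat (hpd n k)
  have key : ∀ {e : ℕ → ℕ} {x : ℚ}, x ∈ padicIntegralRat (p k) → {n | e n ≠ 0}.Finite →
      q = x + ∑ᶠ n : ℕ, (e n : ℚ) * (1 / ((d n : ℚ) * (p n : ℚ))) →
      q - (e k : ℚ) * (1 / ((d k : ℚ) * (p k : ℚ))) ∈ padicIntegralRat (p k) := by
    intro e x hx he hqe
    rw [finsum_eq_sum_of_support_subset (s := insert k he.toFinset),
      ← Finset.add_sum_erase _ _ (Finset.mem_insert_self _ _)] at hqe
    · rw [hqe, add_sub_assoc, add_sub_cancel_left]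
      refine add_mem hx (sum_mem fun n hn => natCast_mul_mem_padicIntegralRat ?_ _)
      rw [← Nat.cast_mul]
      refine one_div_natCast_mem_padicIntegralRat fun hdvd => ?_
      rcases (hp k).dvd_mul.1 hdvd with h1 | h1
      · exact hpd n k h1
      · exact Finset.ne_of_mem_erase hn
          (hpinj ((Nat.prime_dvd_prime_iff_eq (hp k) (hp n)).1 h1)).symm
    · intro n hn
      have : e n ≠ 0 := fun h0 => hn (by simp [h0])
      simp [this]
  have hdvd : (p k : ℤ) ∣ (c' k : ℤ) - c k := by
    refine dvd_of_mul_one_div_mem_padicIntegralRat (hpd k k) ?_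
    convert sub_mem (key (hN a ha) hfin hq) (key (hN b hb) hfin' hq') using 1
    push_cast
    ring
  exact Nat.ModEq.eq_of_lt_of_lt (Nat.modEq_iff_dvd.2 hdvd) (hc k) (hc' k)

/-- Let `(dₙ)` be a strictly increasing sequence of positive integers and `(pₙ)` a
sequence of pairwise distinct primes with `pₙ ∤ dₘ` for all `m, n`, and let
`M = ⟨1/(dₙ pₙ) : n⟩` and `N = ⟨1/dₙ : n⟩`. Then every `q ∈ M` has a unique canonical
sum decomposition `q = c₀ + Σₙ cₙ · 1/(dₙ pₙ)`. -/
theorem gramsLike_canonical_decomposition (d p : ℕ → ℕ)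
    (hdpos : ∀ n, 0 < d n) (hdmono : StrictMono d)
    (hp : ∀ n, Nat.Prime (p n)) (hpinj : Function.Injective p)
    (hpd : ∀ m n, ¬ p n ∣ d m)
    (M N : AddSubmonoid ℚ)
    (hM : M = AddSubmonoid.closure {q : ℚ | ∃ n : ℕ, q = 1 / ((d n : ℚ) * (p n : ℚ))})
    (hN : N = AddSubmonoid.closure {q : ℚ | ∃ n : ℕ, q = 1 / (d n : ℚ)}) :
    ∀ q ∈ M, ∃ (c0 : ℚ) (c : ℕ → ℕ), IsCanonDecomp d p N q c0 c ∧
      ∀ (c0' : ℚ) (c' : ℕ → ℕ), IsCanonDecomp d p N q c0' c' → c0' = c0 ∧ c' = c := by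
  subst hM hN
  intro q hq
  obtain ⟨c0, c, h⟩ := exists_isCanonDecomp (fun n => (hp n).pos) hq
  exact ⟨c0, c, h, fun _ _ h' => h'.unique hp hpinj hpd h⟩
end

section
/- Let (d_n)_{n ≥ 1} be a strictly increasing sequence of positive integers and (p_n)_{n ≥ 1} a sequence of pairwise distinct primes such that p_n does not divide d_m for any m, n ∈ ℕ. Let M be the Puiseux monoid generated by {1/(d_n p_n) : n ∈ ℕ} and N the Puiseux monoid generated by {1/d_n : n ∈ ℕ}. If N is a valuation monoid, then M is an MCD monoid. -/
/-- If a finite combination of the `1 / (dₙ pₙ)` has all coefficients `cₙ < pₙ`, then it has no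
other representation with natural coefficients. -/
theorem linearCombination_unique_of_lt {d p : ℕ → ℕ} (hdpos : ∀ n, 0 < d n)
    (hp : ∀ n, Nat.Prime (p n)) (hpinj : Function.Injective p) (hpd : ∀ m n, ¬ p n ∣ d m)
    {c g : ℕ →₀ ℕ} (hc : ∀ n, c n < p n)
    (h : Finsupp.linearCombination ℕ (fun n => 1 / ((d n : ℚ) * p n)) g =
      Finsupp.linearCombination ℕ (fun n => 1 / ((d n : ℚ) * p n)) c) : g = c := by
  set T := g.support ∪ c.support
  have hd0 : ∀ n, (d n : ℚ) ≠ 0 := fun n => by exact_mod_cast (hdpos n).ne'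
  have hp0 : ∀ n, (p n : ℚ) ≠ 0 := fun n => by exact_mod_cast (hp n).ne_zero
  have hsum : ∑ n ∈ T, ((g n : ℚ) - c n) * (1 / ((d n : ℚ) * p n)) = 0 := by
    rw [Finsupp.linearCombination_apply, Finsupp.linearCombination_apply,
      Finsupp.sum_of_support_subset g Finset.subset_union_left _ (by simp),
      Finsupp.sum_of_support_subset c Finset.subset_union_right _ (by simp)] at h
    simp only [sub_mul, Finset.sum_sub_distrib]
    simpa [nsmul_eq_mul, sub_eq_zero] using h
  have hle : ∀ n, c n ≤ g n := by
    intro n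
    by_cases hn : n ∈ T
    swap
    · simp only [T, Finset.mem_union, Finsupp.mem_support_iff, not_or, not_not] at hn
      omega
    have : Fact (p n).Prime := ⟨hp n⟩
    rw [← Finset.add_sum_erase _ _ hn, add_eq_zero_iff_eq_neg] at hsum
    have hrest : padicNorm (p n)
        (∑ m ∈ T.erase n, ((g m : ℚ) - c m) * (1 / ((d m : ℚ) * p m))) ≤ 1 := by
      refine padicNorm.sum_le' (fun m hm => ?_) zero_le_one
      have hmn : ¬ p n ∣ p m := fun hdvd =>
        (Finset.ne_of_mem_erase hm) (hpinj ((Nat.prime_dvd_prime_iff_eq (hp n) (hp m)).1 hdvd)).symm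
      have h1 : padicNorm (p n) (d m) = 1 := padicNorm.nat_eq_one_iff _ |>.2 (hpd m n)
      have h2 : padicNorm (p n) (p m) = 1 := padicNorm.nat_eq_one_iff _ |>.2 hmn
      have h3 := padicNorm.of_int (p := p n) ((g m : ℤ) - c m)
      push_cast at h3
      rw [padicNorm.mul, padicNorm.div, padicNorm.mul, h1, h2]
      simpa using h3
    have hlt : padicNorm (p n) (((g n : ℤ) - c n : ℤ) : ℚ) < 1 := by
      have h1 : padicNorm (p n) (d n) = 1 := padicNorm.nat_eq_one_iff _ |>.2 (hpd n n)
      have h2 : padicNorm (p n) (p n) < 1 := padicNorm.padicNorm_p_lt_one_of_prime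
      have h3 : (((g n : ℤ) - c n : ℤ) : ℚ) =
          (((g n : ℚ) - c n) * (1 / ((d n : ℚ) * p n))) * (d n * p n) := by
        have := hd0 n
        have := hp0 n
        push_cast
        field_simp
      rw [h3, hsum, padicNorm.mul, padicNorm.neg, padicNorm.mul, h1, one_mul]
      exact (mul_le_of_le_one_left (padicNorm.nonneg _) hrest).trans_lt h2
    rw [padicNorm.int_lt_one_iff] at hlt
    by_contra! hgc
    have := Int.le_of_dvd (by omega) (dvd_neg.2 hlt)
    have := hc n
    omega
  have hzero := (Finset.sum_eq_zero_iff_of_nonneg (fun n _ => mul_nonneg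
    (sub_nonneg.2 (Nat.cast_le.2 (hle n))) (by positivity))).1 hsum
  ext n
  by_cases hn : n ∈ T
  · have hz := hzero n hn
    have hne : 1 / ((d n : ℚ) * p n) ≠ 0 := one_div_ne_zero (mul_ne_zero (hd0 n) (hp0 n))
    exact_mod_cast sub_eq_zero.1 ((mul_eq_zero.1 hz).resolve_right hne)
  · simp only [T, Finset.mem_union, Finsupp.mem_support_iff, not_or, not_not] at hn
    omega

theorem mem_closure_iff_linearCombination {u : ℕ → ℚ} {x : ℚ} :
    x ∈ AddSubmonoid.closure {q | ∃ n, q = u n} ↔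
      ∃ g : ℕ →₀ ℕ, Finsupp.linearCombination ℕ u g = x := by
  have : {q | ∃ n, q = u n} = Set.range u := by ext q; simp [eq_comm]
  rw [this, ← Submodule.span_nat_eq_addSubmonoidClosure, Submodule.mem_toAddSubmonoid,
    Finsupp.mem_span_range_iff_exists_finsupp]
  rfl

/-- Reducing the `n`th coefficient modulo `pₙ` splits off an element of `⟨1 / dₙ : n⟩`. -/
theorem exists_linearCombination_lt_add {d p : ℕ → ℕ} (hp : ∀ n, Nat.Prime (p n)) (g : ℕ →₀ ℕ) :
    ∃ c : ℕ →₀ ℕ, (∀ n, c n < p n) ∧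
      ∃ v ∈ AddSubmonoid.closure {q : ℚ | ∃ n : ℕ, q = 1 / (d n : ℚ)},
        Finsupp.linearCombination ℕ (fun n => 1 / ((d n : ℚ) * p n)) g =
          v + Finsupp.linearCombination ℕ (fun n => 1 / ((d n : ℚ) * p n)) c := by
  let c : ℕ →₀ ℕ := Finsupp.onFinset g.support (fun n => g n % p n) (fun n hn => by
    rw [Finsupp.mem_support_iff]
    intro h
    simp [h] at hn)
  refine ⟨c, fun n => Nat.mod_lt _ (hp n).pos,
    ∑ n ∈ g.support, (g n / p n) • (1 / (d n : ℚ)), ?_, ?_⟩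
  · exact AddSubmonoid.sum_mem _ fun n _ =>
      nsmul_mem (AddSubmonoid.mem_closure_of_mem (Set.mem_ofPred.2 ⟨n, rfl⟩)) _
  · have hcs : c.support ⊆ g.support := Finsupp.support_onFinset_subset
    rw [Finsupp.linearCombination_apply, Finsupp.linearCombination_apply,
      Finsupp.sum_of_support_subset c hcs _ (by simp), Finsupp.sum, ← Finset.sum_add_distrib]
    refine Finset.sum_congr rfl fun n _ => ?_
    have hp0 : (p n : ℚ) ≠ 0 := by exact_mod_cast (hp n).ne_zero
    have hdm : (g n : ℚ) = p n * (g n / p n : ℕ) + (g n % p n : ℕ) := by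
      exact_mod_cast (Nat.div_add_mod (g n) (p n)).symm
    have hcn : c n = g n % p n := rfl
    rw [hcn, nsmul_eq_mul, nsmul_eq_mul, nsmul_eq_mul, hdm]
    by_cases hd0 : (d n : ℚ) = 0
    · simp [hd0]
    · field_simp

/-- Let `(dₙ)` be a strictly increasing sequence of positive integers and `(pₙ)` a
sequence of pairwise distinct primes with `pₙ ∤ dₘ` for all `m, n`. If the Puiseux monoid
`N = ⟨1/dₙ : n⟩` is a valuation monoid, then the Grams-like monoid `M = ⟨1/(dₙ pₙ) : n⟩`
is an MCD monoid: every nonempty finite subset of `M` has a maximal common divisor. -/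
theorem gramsLike_mcd_monoid (d p : ℕ → ℕ)
    (hdpos : ∀ n, 0 < d n) (hdmono : StrictMono d)
    (hp : ∀ n, Nat.Prime (p n)) (hpinj : Function.Injective p)
    (hpd : ∀ m n, ¬ p n ∣ d m)
    (M N : AddSubmonoid ℚ)
    (hM : M = AddSubmonoid.closure {q : ℚ | ∃ n : ℕ, q = 1 / ((d n : ℚ) * (p n : ℚ))})
    (hN : N = AddSubmonoid.closure {q : ℚ | ∃ n : ℕ, q = 1 / (d n : ℚ)})
    (hval : ∀ b ∈ N, ∀ c ∈ N, DvdIn N b c ∨ DvdIn N c b) :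
    ∀ S : Set ℚ, S.Finite → S.Nonempty → S ⊆ (M : Set ℚ) → ∃ m, IsMCDIn M m S := by
  set φ := Finsupp.linearCombination ℕ (fun n => 1 / ((d n : ℚ) * p n)) with hφ
  have hMφ : ∀ x, x ∈ M ↔ ∃ g, φ g = x := fun x => by
    rw [hM]
    exact mem_closure_iff_linearCombination
  have hM0 : ∀ x ∈ M, 0 ≤ x := by
    rw [hM]
    intro x hx
    have hle : AddSubmonoid.closure {q : ℚ | ∃ n : ℕ, q = 1 / ((d n : ℚ) * (p n : ℚ))} ≤
        AddSubmonoid.nonneg ℚ := by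
      rw [AddSubmonoid.closure_le]
      rintro _ ⟨n, rfl⟩
      exact AddSubmonoid.mem_nonneg.2 (by positivity)
    exact AddSubmonoid.mem_nonneg.1 (hle hx)
  have hNM : N ≤ M := by
    rw [hN, AddSubmonoid.closure_le]
    rintro _ ⟨n, rfl⟩
    have hp0 : (p n : ℚ) ≠ 0 := by exact_mod_cast (hp n).ne_zero
    refine (hMφ _).2 ⟨Finsupp.single n (p n), ?_⟩
    rw [hφ, Finsupp.linearCombination_single, nsmul_eq_mul]
    field_simp
  have hNsub : ∀ a ∈ N, ∀ b ∈ N, a ≤ b → b - a ∈ N := by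
    intro a ha b hb hab
    obtain ⟨e, he, rfl⟩ | ⟨e, he, rfl⟩ := hval a ha b hb
    · simpa using he
    · have := hM0 e (hNM he)
      have he0 : e = 0 := by linarith
      simp [he0]
  intro S hfin hne hSM
  have hdec : ∀ s, ∃ (v : ℚ) (c : ℕ →₀ ℕ), s ∈ S → v ∈ N ∧ (∀ n, c n < p n) ∧ s = v + φ c := by
    intro s
    by_cases hs : s ∈ S
    · obtain ⟨g, rfl⟩ := (hMφ s).1 (hSM hs)
      obtain ⟨c, hc, v, hv, h⟩ := exists_linearCombination_lt_add (d := d) hp g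
      exact ⟨v, c, fun _ => ⟨hN ▸ hv, hc, h⟩⟩
    · exact ⟨0, 0, fun h => absurd h hs⟩
  choose v c hvc using hdec
  obtain ⟨t, ht, hmin⟩ := S.exists_min_image v hfin hne
  obtain ⟨hvt, hct, htt⟩ := hvc t ht
  let C : Set ℚ := {m | m ∈ M ∧ ∀ s ∈ S, DvdIn M (v t + m) s}
  have hCfin : C.Finite := by
    refine ((Set.finite_Iic (c t)).image φ).subset ?_
    rintro m ⟨hm, hmS⟩
    obtain ⟨f, hf, htf⟩ := hmS t ht
    obtain ⟨a, rfl⟩ := (hMφ m).1 hm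
    obtain ⟨b, rfl⟩ := (hMφ f).1 hf
    have hab : a + b = c t := by
      refine linearCombination_unique_of_lt hdpos hp hpinj hpd hct ?_
      change φ (a + b) = φ (c t)
      rw [map_add]
      linarith
    exact ⟨a, hab ▸ Set.mem_Iic.2 le_self_add, rfl⟩
  have hC0 : (0 : ℚ) ∈ C := by
    refine ⟨M.zero_mem, fun s hs => ⟨v s - v t + φ (c s), ?_, ?_⟩⟩
    · exact M.add_mem (hNM (hNsub _ hvt _ (hvc s hs).1 (hmin s hs))) ((hMφ _).2 ⟨_, rfl⟩)
    · linarith [(hvc s hs).2.2]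
  obtain ⟨m, hm, hmax⟩ := C.exists_max_image id hCfin ⟨0, hC0⟩
  refine ⟨v t + m, M.add_mem (hNM hvt) hm.1, hm.2, fun e he hdiv => ?_⟩
  have hmem : m + e ∈ C := by
    refine ⟨M.add_mem hm.1 he, fun s hs => ?_⟩
    obtain ⟨f, hf, hsf⟩ := hdiv s hs
    exact ⟨f, hf, by linarith⟩
  have hle : m + e ≤ m := hmax _ hmem
  have he0 : e = 0 := le_antisymm (by linarith) (hM0 e he)
  exact ⟨he, 0, M.zero_mem, by simp [he0]⟩
end

section
/- Let (d_n)_{n ≥ 1} be a strictly increasing sequence of positive integers and (p_n)_{n ≥ 1} a sequence of pairwise distinct primes such that p_n does not divide d_m for any m, n ∈ ℕ. Let M be the Puiseux monoid generated by {1/(d_n p_n) : n ∈ ℕ} and N the Puiseux monoid generated by {1/d_n : n ∈ ℕ}, and let S be a nonempty subset of M. If d ∈ M is a common divisor of S in M and n is a positive integer such that c_n(s) = 0 for all s ∈ S and c_n(d) > 0, then d + (p_n − c_n(d))/(d_n p_n) is also a common divisor of S in M. -/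
lemma finite_support_natCast_mul {c : ℕ → ℕ} (hc : {m | c m ≠ 0}.Finite) (g : ℕ → ℚ) :
    (Function.support fun m => (c m : ℚ) * g m).Finite :=
  hc.subset fun m hm h => hm (by simp [h])

/-- Carrying multiples of `pₘ` over to the `N`-part turns a decomposition with arbitrary
finitely supported coefficients into a canonical one. -/
lemma isCanonDecomp_mod {d p : ℕ → ℕ} {N : AddSubmonoid ℚ} (hp : ∀ m, 0 < p m)
    (hN : ∀ m, 1 / (d m : ℚ) ∈ N) {c0 : ℚ} (hc0 : c0 ∈ N) {c : ℕ → ℕ}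
    (hc : {m | c m ≠ 0}.Finite) :
    IsCanonDecomp d p N (c0 + ∑ᶠ m, (c m : ℚ) * (1 / ((d m : ℚ) * (p m : ℚ))))
      (c0 + ∑ᶠ m, ((c m / p m : ℕ) : ℚ) * (1 / (d m : ℚ))) (fun m => c m % p m) := by
  have hdiv : {m | c m / p m ≠ 0}.Finite := hc.subset fun m hm h => hm (by simp [h])
  have hmod : {m | c m % p m ≠ 0}.Finite := hc.subset fun m hm h => hm (by simp [h])
  refine ⟨N.add_mem hc0 (finsum_induction (· ∈ N) N.zero_mem (fun _ _ => N.add_mem) fun m => ?_),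
    fun m => Nat.mod_lt _ (hp m), hmod, ?_⟩
  · rw [← nsmul_eq_mul]
    exact N.nsmul_mem (hN m) _
  · rw [add_assoc, ← finsum_add_distrib (finite_support_natCast_mul hdiv _)
      (finite_support_natCast_mul hmod _)]
    congr 1
    refine finsum_congr fun m => ?_
    have hpm : (p m : ℚ) ≠ 0 := Nat.cast_ne_zero.mpr (hp m).ne'
    have hcm : (c m : ℚ) = (p m : ℚ) * (c m / p m : ℕ) + (c m % p m : ℕ) := by
      exact_mod_cast (Nat.div_add_mod (c m) (p m)).symm
    rw [hcm]
    generalize ((c m / p m : ℕ) : ℚ) = a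
    generalize ((c m % p m : ℕ) : ℚ) = b
    rw [one_div, one_div, mul_inv]
    field_simp

/-- Canonical decompositions can be added, with carries. -/
lemma IsCanonDecomp.add {d p : ℕ → ℕ} {N : AddSubmonoid ℚ} (hp : ∀ m, 0 < p m)
    (hN : ∀ m, 1 / (d m : ℚ) ∈ N) {x y x0 y0 : ℚ} {cx cy : ℕ → ℕ}
    (hx : IsCanonDecomp d p N x x0 cx) (hy : IsCanonDecomp d p N y y0 cy) :
    ∃ z0, IsCanonDecomp d p N (x + y) z0 (fun m => (cx m + cy m) % p m) := by
  obtain ⟨hx0, -, hxf, hx⟩ := hx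
  obtain ⟨hy0, -, hyf, hy⟩ := hy
  have hf : {m | cx m + cy m ≠ 0}.Finite :=
    (hxf.union hyf).subset fun m hm => by
      simp only [Set.mem_union, Set.mem_ofPred_eq] at hm ⊢
      omega
  have key := isCanonDecomp_mod hp hN (N.add_mem hx0 hy0) hf
  have hxy : x + y = x0 + y0 +
      ∑ᶠ m, ((cx m + cy m : ℕ) : ℚ) * (1 / ((d m : ℚ) * (p m : ℚ))) := by
    simp only [Nat.cast_add, add_mul]
    rw [finsum_add_distrib (finite_support_natCast_mul hxf _)
      (finite_support_natCast_mul hyf _), hx, hy]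
    ring
  rw [hxy]
  exact ⟨_, key⟩

lemma exists_isCanonDecomp_s12 {d p : ℕ → ℕ} {N : AddSubmonoid ℚ} (hp : ∀ m, 1 < p m)
    (hN : ∀ m, 1 / (d m : ℚ) ∈ N) {x : ℚ}
    (hx : x ∈ AddSubmonoid.closure {q : ℚ | ∃ m : ℕ, q = 1 / ((d m : ℚ) * (p m : ℚ))}) :
    ∃ x0 c, IsCanonDecomp d p N x x0 c := by
  have hp0 : ∀ m, 0 < p m := fun m => zero_lt_one.trans (hp m)
  induction hx using AddSubmonoid.closure_induction with
  | mem x hx =>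
    obtain ⟨n, rfl⟩ := hx
    refine ⟨0, Pi.single n 1, N.zero_mem, fun m => ?_, ?_, ?_⟩
    · by_cases h : m = n
      · subst h; simpa using hp m
      · simpa [h] using hp0 m
    · exact (Set.finite_singleton n).subset fun m hm => by
        by_contra h
        exact hm (Pi.single_eq_of_ne h _)
    · rw [finsum_eq_single _ n fun m hm => by simp [hm]]
      simp
  | zero => exact ⟨0, 0, N.zero_mem, hp0, by simp, by simp⟩
  | add x y _ _ ihx ihy =>
    obtain ⟨x0, cx, hx⟩ := ihx
    obtain ⟨y0, cy, hy⟩ := ihy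
    obtain ⟨z0, hz⟩ := hx.add hp0 hN hy
    exact ⟨z0, _, hz⟩

/-- Dropping a single coefficient from a canonical decomposition stays in the monoid. -/
lemma IsCanonDecomp.sub_mem {d p : ℕ → ℕ} {M N : AddSubmonoid ℚ} (hNM : N ≤ M)
    (hM : ∀ m, 1 / ((d m : ℚ) * (p m : ℚ)) ∈ M) {x x0 : ℚ} {c : ℕ → ℕ}
    (hx : IsCanonDecomp d p N x x0 c) (n : ℕ) :
    x - (c n : ℚ) * (1 / ((d n : ℚ) * (p n : ℚ))) ∈ M := by
  obtain ⟨hx0, -, hf, hx⟩ := hx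
  rw [hx, finsum_eq_sum_of_support_subset (s := insert n hf.toFinset) _ fun m hm => ?_,
    ← Finset.add_sum_erase _ _ (Finset.mem_insert_self n hf.toFinset), add_sub_assoc,
    add_sub_cancel_left]
  · refine M.add_mem (hNM hx0) (M.sum_mem fun m _ => ?_)
    rw [← nsmul_eq_mul]
    exact M.nsmul_mem (hM m) _
  · have : c m ≠ 0 := fun h => hm (by simp [h])
    simp [this]

/-- With `M = ⟨1/(dₙ pₙ) : n⟩` and `N = ⟨1/dₙ : n⟩` as in the Grams-like construction,
let `S` be a nonempty subset of `M`. If `e ∈ M` is a common divisor of `S` in `M` and `n`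
is an index such that `cₙ(s) = 0` for all `s ∈ S` while `cₙ(e) > 0` (coefficients taken
from canonical sum decompositions), then `e + (pₙ - cₙ(e))/(dₙ pₙ)` is also a common
divisor of `S` in `M`. -/
theorem gramsLike_common_divisor_lemma (d p : ℕ → ℕ)
    (hdpos : ∀ n, 0 < d n) (hdmono : StrictMono d)
    (hp : ∀ n, Nat.Prime (p n)) (hpinj : Function.Injective p)
    (hpd : ∀ m n, ¬ p n ∣ d m)
    (M N : AddSubmonoid ℚ)
    (hM : M = AddSubmonoid.closure {q : ℚ | ∃ n : ℕ, q = 1 / ((d n : ℚ) * (p n : ℚ))})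
    (hN : N = AddSubmonoid.closure {q : ℚ | ∃ n : ℕ, q = 1 / (d n : ℚ)})
    (S : Set ℚ) (hS : S.Nonempty) (hSM : S ⊆ (M : Set ℚ))
    (e : ℚ) (heM : e ∈ M) (hcd : ∀ s ∈ S, DvdIn M e s)
    (n : ℕ) (e0 : ℚ) (ce : ℕ → ℕ) (hce : IsCanonDecomp d p N e e0 ce) (hn : 0 < ce n)
    (hzero : ∀ s ∈ S, ∀ (s0 : ℚ) (cs : ℕ → ℕ), IsCanonDecomp d p N s s0 cs → cs n = 0) :
    (e + ((p n : ℚ) - (ce n : ℚ)) / ((d n : ℚ) * (p n : ℚ))) ∈ M ∧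
      ∀ s ∈ S, DvdIn M (e + ((p n : ℚ) - (ce n : ℚ)) / ((d n : ℚ) * (p n : ℚ))) s := by
  have hp0 : ∀ m, 0 < p m := fun m => (hp m).pos
  have hMg : ∀ m, 1 / ((d m : ℚ) * (p m : ℚ)) ∈ M := fun m =>
    hM ▸ AddSubmonoid.subset_closure ⟨m, rfl⟩
  have hNg : ∀ m, 1 / (d m : ℚ) ∈ N := fun m => hN ▸ AddSubmonoid.subset_closure ⟨m, rfl⟩
  have hNM : N ≤ M := by
    rw [hN, AddSubmonoid.closure_le]
    rintro _ ⟨m, rfl⟩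
    have hpm : (p m : ℚ) ≠ 0 := Nat.cast_ne_zero.mpr (hp0 m).ne'
    have h : 1 / (d m : ℚ) = p m • (1 / ((d m : ℚ) * (p m : ℚ))) := by
      rw [nsmul_eq_mul, one_div, one_div, mul_inv, mul_left_comm, mul_inv_cancel₀ hpm, mul_one]
    rw [h]
    exact M.nsmul_mem (hMg m) _
  have hsub : ((p n : ℚ) - (ce n : ℚ)) / ((d n : ℚ) * (p n : ℚ)) =
      ((p n - ce n : ℕ) : ℚ) * (1 / ((d n : ℚ) * (p n : ℚ))) := by
    rw [Nat.cast_sub (hce.2.1 n).le, mul_one_div]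
  rw [hsub]
  refine ⟨M.add_mem heM ?_, fun s hs => ?_⟩
  · rw [← nsmul_eq_mul]
    exact M.nsmul_mem (hMg n) _
  · obtain ⟨f, hf, rfl⟩ := hcd s hs
    obtain ⟨f0, cf, hcf⟩ := exists_isCanonDecomp_s12 (fun m => (hp m).one_lt) hNg (hM ▸ hf)
    obtain ⟨s0, hcs⟩ := hce.add hp0 hNg hcf
    have hmod : (ce n + cf n) % p n = 0 := hzero _ hs _ _ hcs
    have hcfn : cf n = p n - ce n := by
      have h1 := hce.2.1 n
      have h2 := hcf.2.1 n
      obtain ⟨k, hk⟩ := Nat.dvd_of_mod_eq_zero hmod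
      have hk1 : k = 1 := by
        have : k ≠ 0 := by rintro rfl; omega
        have : k < 2 := by
          by_contra! h
          have := Nat.mul_le_mul_left (p n) h
          omega
        omega
      subst hk1
      omega
    refine ⟨_, hcfn ▸ hcf.sub_mem hNM hMg n, ?_⟩
    ring
end

section
/- Let (p_n)_{n ≥ 1} be a strictly increasing sequence of primes, and let M be the Puiseux monoid generated by {1/(p_n p_{n+2}) : n ∈ ℕ} (the 2-prime reciprocal Puiseux monoid of (p_n)_{n ≥ 1}). Then M is atomic and its set of atoms is exactly {1/(p_n p_{n+2}) : n ∈ ℕ}. -/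
section

open Finset

lemma padicNorm_natCast_div_le_one {q d : ℕ} [Fact q.Prime] (x : ℕ) (hd : ¬ q ∣ d) :
    padicNorm q ((x : ℚ) / d) ≤ 1 := by
  rw [padicNorm.div, (padicNorm.nat_eq_one_iff d).2 hd, div_one]
  exact padicNorm.of_nat x

lemma padicNorm_sub_le_one {q : ℕ} [Fact q.Prime] {x y : ℚ}
    (hx : padicNorm q x ≤ 1) (hy : padicNorm q y ≤ 1) : padicNorm q (x - y) ≤ 1 :=
  padicNorm.sub.trans (max_le hx hy)

/-- The reciprocal `1 / (pₙ pₙ₊₂)`. -/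
def twoPrimeRecip (p : ℕ → ℕ) (n : ℕ) : ℚ := 1 / ((p n : ℚ) * (p (n + 2) : ℚ))

lemma twoPrimeRecip_pos {p : ℕ → ℕ} (hp : ∀ n, Nat.Prime (p n)) (n : ℕ) :
    0 < twoPrimeRecip p n := by
  have h₁ : (0 : ℚ) < p n := mod_cast (hp n).pos
  have h₂ : (0 : ℚ) < p (n + 2) := mod_cast (hp (n + 2)).pos
  unfold twoPrimeRecip
  positivity

lemma StrictMono.not_dvd_of_prime {p : ℕ → ℕ} (hmono : StrictMono p)
    (hp : ∀ n, Nat.Prime (p n)) {m n : ℕ} (h : m ≠ n) : ¬ p m ∣ p n := fun hd =>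
  h (hmono.injective ((Nat.prime_dvd_prime_iff_eq (hp m) (hp n)).1 hd))

lemma padicNorm_twoPrimeRecip_le_one {p : ℕ → ℕ} (hp : ∀ n, Nat.Prime (p n))
    (hmono : StrictMono p) {m k : ℕ} [Fact (p m).Prime] (h₁ : m ≠ k) (h₂ : m ≠ k + 2) :
    padicNorm (p m) (twoPrimeRecip p k) ≤ 1 := by
  have h : ¬ p m ∣ p k * p (k + 2) := by
    rw [(hp m).dvd_mul, not_or]
    exact ⟨hmono.not_dvd_of_prime hp h₁, hmono.not_dvd_of_prime hp h₂⟩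
  have := padicNorm_natCast_div_le_one 1 h
  simpa only [twoPrimeRecip, Nat.cast_one, Nat.cast_mul] using this

lemma padicNorm_sum_twoPrimeRecip_le_one {p : ℕ → ℕ} (hp : ∀ n, Nat.Prime (p n))
    (hmono : StrictMono p) (c : ℕ → ℕ) (N : ℕ) [Fact (p (N + 2)).Prime] :
    padicNorm (p (N + 2)) (∑ k ∈ range N, c k * twoPrimeRecip p k) ≤ 1 := by
  refine padicNorm.sum_le' (fun k hk => ?_) zero_le_one
  rw [mem_range] at hk
  rw [padicNorm.mul]
  exact mul_le_one₀ (padicNorm.of_nat _) (padicNorm.nonneg _)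
    (padicNorm_twoPrimeRecip_le_one hp hmono (by lia) (by lia))

/-- The remainders `x / p_N` and `y / p_{N+1}` collect the terms of index at least `N`, one for
each parity class. -/
lemma sum_add_ne_twoPrimeRecip {p : ℕ → ℕ} (hp : ∀ n, Nat.Prime (p n))
    (hmono : StrictMono p) {n : ℕ} (c : ℕ → ℕ) {N : ℕ} (hN : n + 1 ≤ N) (hc : c n = 0)
    (x y : ℕ) :
    ∑ k ∈ range N, c k * twoPrimeRecip p k + (x : ℚ) / p N + (y : ℚ) / p (N + 1) ≠
      twoPrimeRecip p n := by
  have hpos : ∀ k, (0 : ℚ) < p k := fun k => mod_cast (hp k).pos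
  induction N, hN using Nat.le_induction generalizing x y with
  | base =>
    intro h
    rw [sum_range_succ, hc, Nat.cast_zero, zero_mul, add_zero] at h
    have : Fact (p (n + 2)).Prime := ⟨hp _⟩
    have hsum : 0 ≤ ∑ k ∈ range n, c k * twoPrimeRecip p k :=
      sum_nonneg fun k _ => mul_nonneg (Nat.cast_nonneg _) (twoPrimeRecip_pos hp k).le
    have hx : 0 ≤ (x : ℚ) / p (n + 1) := div_nonneg (Nat.cast_nonneg _) (hpos _).le
    have hy : y = 0 := by
      by_contra hy
      have hy1 : (1 : ℚ) ≤ y := mod_cast Nat.one_le_iff_ne_zero.2 hy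
      have hlt : twoPrimeRecip p n < (y : ℚ) / p (n + 2) := by
        have hp1 : (1 : ℚ) < p n := mod_cast (hp n).one_lt
        rw [twoPrimeRecip, ← div_div]
        refine div_lt_div_of_pos_right (lt_of_lt_of_le ?_ hy1) (hpos _)
        exact (div_lt_one (hpos n)).2 hp1
      have : (p (n + 1 + 1) : ℚ) = p (n + 2) := rfl
      rw [this] at h
      linarith
    subst hy
    rw [Nat.cast_zero, zero_div, add_zero] at h
    have hle : padicNorm (p (n + 2)) (twoPrimeRecip p n) ≤ 1 := by
      rw [← h]
      exact padicNorm.nonarchimedean.trans (max_le (padicNorm_sum_twoPrimeRecip_le_one hp hmono c n)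
        (padicNorm_natCast_div_le_one x (hmono.not_dvd_of_prime hp (by lia))))
    have hone : ((1 : ℕ) : ℚ) = twoPrimeRecip p n * p n * p (n + 2) := by
      have := (hpos n).ne'
      have := (hpos (n + 2)).ne'
      rw [twoPrimeRecip]
      field_simp
      simp
    have hlt : padicNorm (p (n + 2)) ((1 : ℕ) : ℚ) < 1 := by
      rw [hone, padicNorm.mul, padicNorm.mul]
      exact mul_lt_one_of_nonneg_of_lt_one_right
        (mul_le_one₀ hle (padicNorm.nonneg _) (padicNorm.of_nat _)) (padicNorm.nonneg _)
        padicNorm.padicNorm_p_lt_one_of_prime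
    exact (hp _).one_lt.ne' (Nat.dvd_one.1 ((padicNorm.nat_lt_one_iff 1).1 hlt))
  | succ N hN ih =>
    intro h
    have : Fact (p (N + 2)).Prime := ⟨hp _⟩
    have hN0 := (hpos N).ne'
    have hN2 := (hpos (N + 2)).ne'
    change _ + (y : ℚ) / p (N + 2) = _ at h
    rw [sum_range_succ] at h
    set z := twoPrimeRecip p n - ∑ k ∈ range N, c k * twoPrimeRecip p k - (x : ℚ) / p (N + 1)
      with hz
    have hz1 : padicNorm (p (N + 2)) z ≤ 1 :=
      padicNorm_sub_le_one (padicNorm_sub_le_one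
        (padicNorm_twoPrimeRecip_le_one hp hmono (by lia) (by lia))
        (padicNorm_sum_twoPrimeRecip_le_one hp hmono c N))
        (padicNorm_natCast_div_le_one x (hmono.not_dvd_of_prime hp (by lia)))
    have hzeq : z = c N * twoPrimeRecip p N + (y : ℚ) / p (N + 2) := by
      rw [hz]
      linarith
    have hnum : ((c N + y * p N : ℕ) : ℚ) = z * p N * p (N + 2) := by
      rw [hzeq, twoPrimeRecip]
      push_cast
      field_simp
    have hlt : padicNorm (p (N + 2)) ((c N + y * p N : ℕ) : ℚ) < 1 := by
      rw [hnum, padicNorm.mul, padicNorm.mul]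
      exact mul_lt_one_of_nonneg_of_lt_one_right
        (mul_le_one₀ hz1 (padicNorm.nonneg _) (padicNorm.of_nat _)) (padicNorm.nonneg _)
        padicNorm.padicNorm_p_lt_one_of_prime
    obtain ⟨w, hw⟩ := (padicNorm.nat_lt_one_iff _).1 hlt
    have hzw : z = (w : ℚ) / p N := by
      rw [hw] at hnum
      push_cast at hnum
      rw [eq_div_iff hN0]
      exact mul_right_cancel₀ hN2 (by rw [← hnum, mul_comm])
    refine ih w x ?_
    rw [← hzw, hz]
    ring

lemma finsuppSum_ne_twoPrimeRecip {p : ℕ → ℕ} (hp : ∀ n, Nat.Prime (p n))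
    (hmono : StrictMono p) {n : ℕ} (c : ℕ →₀ ℕ) (hc : c n = 0) :
    (c.sum fun k m => m • twoPrimeRecip p k) ≠ twoPrimeRecip p n := by
  obtain ⟨N, hN⟩ := c.support.exists_nat_subset_range
  have hsub : c.support ⊆ range (N + n + 1) :=
    hN.trans (range_subset_range.2 (by lia))
  rw [c.sum_of_support_subset hsub (fun k m => m • twoPrimeRecip p k) (fun k _ => zero_smul ℕ _)]
  simpa only [nsmul_eq_mul, Nat.cast_zero, zero_div, add_zero] using
    sum_add_ne_twoPrimeRecip hp hmono c (N := N + n + 1) (by lia) hc 0 0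

lemma twoPrimeRecip_le_finsuppSum {p : ℕ → ℕ} (hp : ∀ n, Nat.Prime (p n)) {n : ℕ}
    (c : ℕ →₀ ℕ) (hc : c n ≠ 0) :
    twoPrimeRecip p n ≤ c.sum fun k m => m • twoPrimeRecip p k :=
  (le_self_nsmul (twoPrimeRecip_pos hp n).le hc).trans
    (single_le_sum (f := fun k => c k • twoPrimeRecip p k)
      (fun k _ => nsmul_nonneg (twoPrimeRecip_pos hp k).le _) (Finsupp.mem_support_iff.2 hc))

lemma IsUnitIn.eq_zero {M : AddSubmonoid ℚ} (hM : ∀ x ∈ M, 0 ≤ x) {e : ℚ}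
    (he : IsUnitIn M e) : e = 0 := by
  obtain ⟨he, f, hf, h⟩ := he
  linarith [hM e he, hM f hf]

lemma isUnitIn_zero (M : AddSubmonoid ℚ) : IsUnitIn M 0 :=
  ⟨M.zero_mem, 0, M.zero_mem, add_zero 0⟩

lemma nonneg_of_mem_closure_twoPrimeRecip {p : ℕ → ℕ} (hp : ∀ n, Nat.Prime (p n)) {x : ℚ}
    (hx : x ∈ AddSubmonoid.closure (Set.range (twoPrimeRecip p))) : 0 ≤ x := by
  have hle : AddSubmonoid.closure (Set.range (twoPrimeRecip p)) ≤ AddSubmonoid.nonneg ℚ := by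
    rw [AddSubmonoid.closure_le]
    rintro _ ⟨n, rfl⟩
    exact (twoPrimeRecip_pos hp n).le
  exact hle hx

lemma isAtomIn_twoPrimeRecip {p : ℕ → ℕ} (hp : ∀ n, Nat.Prime (p n)) (hmono : StrictMono p)
    (n : ℕ) :
    IsAtomIn (AddSubmonoid.closure (Set.range (twoPrimeRecip p))) (twoPrimeRecip p n) := by
  have hnn := fun x => nonneg_of_mem_closure_twoPrimeRecip hp (x := x)
  refine ⟨AddSubmonoid.subset_closure ⟨n, rfl⟩,
    fun h => (twoPrimeRecip_pos hp n).ne' (h.eq_zero hnn), fun b hb c hc h => ?_⟩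
  have hb0 := hnn b hb
  have hc0 := hnn c hc
  obtain ⟨β, rfl⟩ := AddSubmonoid.mem_closure_range_iff.1 hb
  obtain ⟨γ, rfl⟩ := AddSubmonoid.mem_closure_range_iff.1 hc
  by_cases hβ : β n = 0
  · by_cases hγ : γ n = 0
    · refine absurd ?_ (finsuppSum_ne_twoPrimeRecip hp hmono (β + γ) (n := n) (by simp [hβ, hγ]))
      rw [h]
      exact Finsupp.sum_add_index' (fun k => zero_smul ℕ _) (fun k _ _ => add_smul _ _ _)
    · left
      have := twoPrimeRecip_le_finsuppSum hp γ hγ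
      rw [show (β.sum fun k m => m • twoPrimeRecip p k) = 0 by linarith]
      exact isUnitIn_zero _
  · right
    have := twoPrimeRecip_le_finsuppSum hp β hβ
    rw [show (γ.sum fun k m => m • twoPrimeRecip p k) = 0 by linarith]
    exact isUnitIn_zero _

lemma IsAtomIn.mem_of_closure {A : Set ℚ} (hA : ∀ x ∈ AddSubmonoid.closure A, 0 ≤ x) {a : ℚ}
    (ha : IsAtomIn (AddSubmonoid.closure A) a) : a ∈ A := by
  have hmem := ha.1
  induction hmem using AddSubmonoid.closure_induction with
  | mem x hx => exact hx
  | zero => exact absurd (isUnitIn_zero _) ha.2.1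
  | add x y hx hy ihx ihy =>
    rcases ha.2.2 x hx y hy rfl with h | h
    · rw [h.eq_zero hA, zero_add] at ha ⊢
      exact ihy ha
    · rw [h.eq_zero hA, add_zero] at ha ⊢
      exact ihx ha

lemma atomicIn_closure_s14 {A : Set ℚ} (hA : ∀ a ∈ A, IsAtomIn (AddSubmonoid.closure A) a) :
    AtomicIn (AddSubmonoid.closure A) := by
  intro x hx _
  obtain ⟨l, hl, rfl⟩ := AddSubmonoid.exists_list_of_mem_closure hx
  exact ⟨l.length, l.get, fun i => hA _ (hl _ (l.get_mem i)), by
    rw [← List.sum_ofFn, List.ofFn_get]⟩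

end

/-- Let `(pₙ)` be a strictly increasing sequence of primes (indexed here by `n : ℕ`).
Then the 2-prime reciprocal Puiseux monoid `M = ⟨1/(pₙ pₙ₊₂) : n⟩` is atomic and its set
of atoms is exactly `{1/(pₙ pₙ₊₂) : n}`. -/
theorem twoPrimeReciprocal_atomic (p : ℕ → ℕ)
    (hp : ∀ n, Nat.Prime (p n)) (hmono : StrictMono p)
    (M : AddSubmonoid ℚ)
    (hM : M = AddSubmonoid.closure
      {q : ℚ | ∃ n : ℕ, q = 1 / ((p n : ℚ) * (p (n + 2) : ℚ))}) :
    AtomicIn M ∧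
      {a : ℚ | IsAtomIn M a} =
        {q : ℚ | ∃ n : ℕ, q = 1 / ((p n : ℚ) * (p (n + 2) : ℚ))} := by
  have hset : {q : ℚ | ∃ n : ℕ, q = 1 / ((p n : ℚ) * (p (n + 2) : ℚ))} =
      Set.range (twoPrimeRecip p) := by
    ext q
    simp only [Set.mem_ofPred_eq, Set.mem_range, twoPrimeRecip, eq_comm]
  rw [hset] at hM ⊢
  subst hM
  have hatom : ∀ a ∈ Set.range (twoPrimeRecip p),
      IsAtomIn (AddSubmonoid.closure (Set.range (twoPrimeRecip p))) a := by
    rintro _ ⟨n, rfl⟩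
    exact isAtomIn_twoPrimeRecip hp hmono n
  exact ⟨atomicIn_closure_s14 hatom, Set.Subset.antisymm
    (fun a ha => ha.mem_of_closure fun _ => nonneg_of_mem_closure_twoPrimeRecip hp) hatom⟩
end

section
/- Let (p_n)_{n ≥ 1} be a strictly increasing sequence of primes, and let M be the Puiseux monoid generated by {1/(p_n p_{n+2}) : n ∈ ℕ} (a 2-prime reciprocal Puiseux monoid). Then M is an MCD monoid: every nonempty finite subset of M has a maximal common divisor in M. -/
/-- The generator `1 / (pₙ pₙ₊₂)` of a 2-prime reciprocal Puiseux monoid. -/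
def twoPrimeAtom (p : ℕ → ℕ) (n : ℕ) : ℚ := 1 / ((p n : ℚ) * (p (n + 2) : ℚ))

/-- The submonoid generated by the first `N + 1` generators. -/
def twoPrimeTrunc (p : ℕ → ℕ) (N : ℕ) : AddSubmonoid ℚ :=
  AddSubmonoid.closure {q | ∃ n ≤ N, q = twoPrimeAtom p n}

/-- A common denominator of the elements of `twoPrimeTrunc p N`. -/
def twoPrimeDenom (p : ℕ → ℕ) (N : ℕ) : ℕ := ∏ i ∈ Finset.range (N + 3), p i

section

variable {p : ℕ → ℕ}

lemma twoPrimeAtom_mem_trunc {n N : ℕ} (h : n ≤ N) : twoPrimeAtom p n ∈ twoPrimeTrunc p N :=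
  AddSubmonoid.subset_closure ⟨n, h, rfl⟩

lemma twoPrimeTrunc_mono : Monotone (twoPrimeTrunc p) := fun _ _ h =>
  AddSubmonoid.closure_mono fun _ ⟨n, hn, hq⟩ => ⟨n, hn.trans h, hq⟩

lemma exists_mem_twoPrimeTrunc {x : ℚ}
    (hx : x ∈ AddSubmonoid.closure {q | ∃ n, q = twoPrimeAtom p n}) :
    ∃ N, x ∈ twoPrimeTrunc p N := by
  induction hx using AddSubmonoid.closure_induction with
  | mem x hx =>
    obtain ⟨n, rfl⟩ := hx
    exact ⟨n, twoPrimeAtom_mem_trunc le_rfl⟩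
  | zero => exact ⟨0, zero_mem _⟩
  | add x y _ _ hx hy =>
    obtain ⟨N, hN⟩ := hx
    obtain ⟨K, hK⟩ := hy
    exact ⟨max N K, add_mem (twoPrimeTrunc_mono (le_max_left N K) hN)
      (twoPrimeTrunc_mono (le_max_right N K) hK)⟩

lemma exists_sub_twoPrimeAtom_mem {x : ℚ}
    (hx : x ∈ AddSubmonoid.closure {q | ∃ n, q = twoPrimeAtom p n}) (h0 : x ≠ 0) :
    ∃ n, x - twoPrimeAtom p n ∈ AddSubmonoid.closure {q | ∃ n, q = twoPrimeAtom p n} := by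
  induction hx using AddSubmonoid.closure_induction with
  | mem x hx =>
    obtain ⟨n, rfl⟩ := hx
    exact ⟨n, by simp⟩
  | zero => exact absurd rfl h0
  | add x y hx hy ihx ihy =>
    by_cases h : x = 0
    · subst h
      simpa using ihy (by simpa using h0)
    · obtain ⟨n, hn⟩ := ihx h
      exact ⟨n, by simpa [sub_add_eq_add_sub] using add_mem hn hy⟩

lemma exists_eq_add_of_mem_twoPrimeTrunc_succ {L : ℕ} {x : ℚ}
    (hx : x ∈ twoPrimeTrunc p (L + 1)) :
    ∃ h ∈ twoPrimeTrunc p L, ∃ c : ℕ, x = h + c * twoPrimeAtom p (L + 1) := by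
  induction hx using AddSubmonoid.closure_induction with
  | mem x hx =>
    obtain ⟨n, hn, rfl⟩ := hx
    rcases hn.lt_or_eq with h | rfl
    · exact ⟨_, twoPrimeAtom_mem_trunc (Nat.lt_succ_iff.1 h), 0, by simp⟩
    · exact ⟨0, zero_mem _, 1, by simp⟩
  | zero => exact ⟨0, zero_mem _, 0, by simp⟩
  | add x y _ _ hx hy =>
    obtain ⟨h, hh, c, rfl⟩ := hx
    obtain ⟨h', hh', c', rfl⟩ := hy
    exact ⟨h + h', add_mem hh hh', c + c', by push_cast; ring⟩

variable (hp : ∀ n, Nat.Prime (p n))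
include hp

lemma twoPrimeAtom_pos (n : ℕ) : 0 < twoPrimeAtom p n := by
  have h₁ := (hp n).pos
  have h₂ := (hp (n + 2)).pos
  unfold twoPrimeAtom
  positivity

lemma twoPrimeDenom_pos (N : ℕ) : 0 < twoPrimeDenom p N :=
  Finset.prod_pos fun i _ => (hp i).pos

lemma exists_twoPrimeDenom_mul_eq {N : ℕ} {x : ℚ} (hx : x ∈ twoPrimeTrunc p N) :
    ∃ k : ℕ, (twoPrimeDenom p N : ℚ) * x = k := by
  induction hx using AddSubmonoid.closure_induction with
  | mem x hx =>
    obtain ⟨n, hn, rfl⟩ := hx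
    have hsub : ({n, n + 2} : Finset ℕ) ⊆ Finset.range (N + 3) := by
      intro i hi
      simp only [Finset.mem_insert, Finset.mem_singleton] at hi
      simp only [Finset.mem_range]
      omega
    obtain ⟨k, hk⟩ := Finset.prod_dvd_prod_of_subset _ _ p hsub
    rw [Finset.prod_pair (by omega)] at hk
    refine ⟨k, ?_⟩
    have h₁ : (p n : ℚ) ≠ 0 := by exact_mod_cast (hp n).ne_zero
    have h₂ : (p (n + 2) : ℚ) ≠ 0 := by exact_mod_cast (hp (n + 2)).ne_zero
    rw [twoPrimeDenom, hk, twoPrimeAtom]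
    push_cast
    field_simp
  | zero => exact ⟨0, by simp⟩
  | add x y _ _ hx hy =>
    obtain ⟨k, hk⟩ := hx
    obtain ⟨l, hl⟩ := hy
    exact ⟨k + l, by push_cast; rw [mul_add, hk, hl]⟩

variable (hmono : StrictMono p)
include hmono

/-- A multiple of the generator of index `l + 2` that lies in the group generated by the earlier
generators is a multiple of `1 / p (l + 2)`, hence of the generator of index `l`. -/
lemma exists_nat_mul_twoPrimeAtom_eq {l c : ℕ} {x y : ℚ} (hx : x ∈ twoPrimeTrunc p (l + 1))
    (hy : y ∈ twoPrimeTrunc p (l + 1)) (h : c * twoPrimeAtom p (l + 2) = x - y) :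
    ∃ k : ℕ, c = k * p (l + 4) ∧
      (c : ℚ) * twoPrimeAtom p (l + 2) = (k * p l : ℕ) * twoPrimeAtom p l := by
  obtain ⟨u, hu⟩ := exists_twoPrimeDenom_mul_eq hp hx
  obtain ⟨v, hv⟩ := exists_twoPrimeDenom_mul_eq hp hy
  have h₀ : (p l : ℚ) ≠ 0 := by exact_mod_cast (hp l).ne_zero
  have h₁ : (p (l + 2) : ℚ) ≠ 0 := by exact_mod_cast (hp (l + 2)).ne_zero
  have h₂ : (p (l + 4) : ℚ) ≠ 0 := by exact_mod_cast (hp (l + 4)).ne_zero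
  have key : (twoPrimeDenom p (l + 1) : ℚ) * c
      = ((u : ℚ) - v) * p (l + 2) * p (l + 4) := by
    rw [← hu, ← hv, ← mul_sub, ← h, twoPrimeAtom]
    field_simp
  have hdvd : (p (l + 4) : ℤ) ∣ (twoPrimeDenom p (l + 1) * c : ℕ) :=
    ⟨((u : ℤ) - v) * p (l + 2), by
      have : (twoPrimeDenom p (l + 1) : ℤ) * c = ((u : ℤ) - v) * p (l + 2) * p (l + 4) := by
        exact_mod_cast key
      push_cast
      rw [this]
      ring⟩
  have hc : p (l + 4) ∣ c := by
    refine ((hp (l + 4)).dvd_mul.1 (Int.natCast_dvd_natCast.1 hdvd)).resolve_left fun hd => ?_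
    obtain ⟨i, hi, hpi⟩ := ((hp (l + 4)).prime.dvd_finsetProd_iff _).1 hd
    have := hmono.injective ((Nat.prime_dvd_prime_iff_eq (hp _) (hp _)).1 hpi)
    simp only [Finset.mem_range] at hi
    omega
  obtain ⟨k, rfl⟩ := hc
  refine ⟨k, mul_comm _ _, ?_⟩
  simp only [twoPrimeAtom]
  push_cast
  field_simp

lemma sub_mem_twoPrimeTrunc_of_succ {l : ℕ} {s t : ℚ} (hs : s ∈ twoPrimeTrunc p (l + 1))
    (ht : t ∈ twoPrimeTrunc p (l + 1)) (h : s - t ∈ twoPrimeTrunc p (l + 2)) :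
    s - t ∈ twoPrimeTrunc p (l + 1) := by
  obtain ⟨y, hy, c, hc⟩ := exists_eq_add_of_mem_twoPrimeTrunc_succ h
  obtain ⟨k, -, hk⟩ := exists_nat_mul_twoPrimeAtom_eq hp hmono hs (add_mem ht hy)
    (c := c) (by linear_combination -hc)
  rw [hc, hk, ← nsmul_eq_mul]
  exact add_mem hy (nsmul_mem (twoPrimeAtom_mem_trunc (by omega)) _)

lemma sub_twoPrimeAtom_mem_trunc_of_succ {l : ℕ} {s : ℚ} (hs : s ∈ twoPrimeTrunc p (l + 1))
    (h : s - twoPrimeAtom p (l + 2) ∈ twoPrimeTrunc p (l + 2)) :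
    s - twoPrimeAtom p l ∈ twoPrimeTrunc p (l + 1) := by
  obtain ⟨y, hy, c, hc⟩ := exists_eq_add_of_mem_twoPrimeTrunc_succ h
  obtain ⟨k, hck, hk⟩ := exists_nat_mul_twoPrimeAtom_eq hp hmono hs hy
    (c := c + 1) (by push_cast; linear_combination -hc)
  have hkpos : 0 < k := Nat.pos_of_ne_zero (by rintro rfl; simp at hck)
  obtain ⟨m, hm⟩ := Nat.exists_eq_succ_of_ne_zero (Nat.mul_pos hkpos (hp l).pos).ne'
  rw [hm] at hk
  push_cast at hk
  have : s - twoPrimeAtom p l = y + m • twoPrimeAtom p l := by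
    rw [nsmul_eq_mul]
    linear_combination hc + hk
  rw [this]
  exact add_mem hy (nsmul_mem (twoPrimeAtom_mem_trunc (by omega)) _)

/-- Divisibility by a generator descends to any truncation, up to replacing the generator by one
that depends only on its index. -/
lemma exists_twoPrimeAtom_sub_mem_trunc (N d : ℕ) :
    ∀ n ≤ N + 1 + d, ∃ m ≤ N + 1, ∀ s ∈ twoPrimeTrunc p (N + 1),
      s - twoPrimeAtom p n ∈ twoPrimeTrunc p (N + 1 + d) →
      s - twoPrimeAtom p m ∈ twoPrimeTrunc p (N + 1) := by
  induction d with
  | zero => exact fun n hn => ⟨n, hn, fun _ _ h => h⟩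
  | succ d ih =>
    have hidx : N + 1 + (d + 1) = N + d + 2 := by omega
    have hidx' : N + 1 + d = N + d + 1 := by omega
    rw [hidx]
    rw [hidx'] at ih
    have hle : twoPrimeTrunc p (N + 1) ≤ twoPrimeTrunc p (N + d + 1) :=
      twoPrimeTrunc_mono (by omega)
    intro n hn
    rcases hn.lt_or_eq with h | rfl
    · obtain ⟨m, hm, H⟩ := ih n (by omega)
      exact ⟨m, hm, fun s hs h' => H s hs (sub_mem_twoPrimeTrunc_of_succ hp hmono (hle hs)
        (twoPrimeAtom_mem_trunc (by omega)) h')⟩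
    · obtain ⟨m, hm, H⟩ := ih (N + d) (by omega)
      exact ⟨m, hm, fun s hs h' =>
        H s hs (sub_twoPrimeAtom_mem_trunc_of_succ hp hmono (hle hs) h')⟩

end

lemma exists_subset_twoPrimeTrunc {p : ℕ → ℕ} {S : Set ℚ} (hS : S.Finite)
    (hSM : ∀ s ∈ S, s ∈ AddSubmonoid.closure {q | ∃ n, q = twoPrimeAtom p n}) :
    ∃ N, ∀ s ∈ S, s ∈ twoPrimeTrunc p N := by
  choose! f hf using fun s hs => exists_mem_twoPrimeTrunc (hSM s hs)
  obtain ⟨N, hN⟩ := (hS.image f).bddAbove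
  exact ⟨N, fun s hs => twoPrimeTrunc_mono (hN ⟨s, hs, rfl⟩) (hf s hs)⟩

/-- Every 2-prime reciprocal Puiseux monoid is an MCD monoid: if `(pₙ)` is a strictly
increasing sequence of primes and `M = ⟨1/(pₙ pₙ₊₂) : n⟩`, then every nonempty finite
subset of `M` has a maximal common divisor in `M`. -/
theorem twoPrimeReciprocal_mcd_monoid (p : ℕ → ℕ)
    (hp : ∀ n, Nat.Prime (p n)) (hmono : StrictMono p)
    (M : AddSubmonoid ℚ)
    (hM : M = AddSubmonoid.closure
      {q : ℚ | ∃ n : ℕ, q = 1 / ((p n : ℚ) * (p (n + 2) : ℚ))}) :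
    ∀ S : Set ℚ, S.Finite → S.Nonempty → S ⊆ (M : Set ℚ) → ∃ m, IsMCDIn M m S := by
  intro S hfin ⟨s₀, hs₀⟩ hSM
  change M = AddSubmonoid.closure {q | ∃ n, q = twoPrimeAtom p n} at hM
  subst hM
  obtain ⟨N, hN⟩ := exists_subset_twoPrimeTrunc hfin hSM
  replace hN : ∀ s ∈ S, s ∈ twoPrimeTrunc p (N + 1) := fun s hs =>
    twoPrimeTrunc_mono (Nat.le_succ N) (hN s hs)
  have hle : twoPrimeTrunc p (N + 1) ≤ AddSubmonoid.closure {q | ∃ n, q = twoPrimeAtom p n} :=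
    AddSubmonoid.closure_mono fun _ ⟨n, _, hq⟩ => ⟨n, hq⟩
  let C : Set ℚ := {d | d ∈ twoPrimeTrunc p (N + 1) ∧ ∀ s ∈ S, s - d ∈ twoPrimeTrunc p (N + 1)}
  have hC : C.Nonempty := ⟨0, zero_mem _, fun s hs => by simpa using hN s hs⟩
  let f : ℚ → ℕ := fun d => ⌊(twoPrimeDenom p (N + 1) : ℚ) * (s₀ - d)⌋₊
  obtain ⟨d, ⟨hdT, hd⟩, hmin⟩ := (measure f).wf.has_min C hC
  refine ⟨d, hle hdT, fun s hs => ⟨s - d, hle (hd s hs), by ring⟩, fun e he hediv => ?_⟩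
  by_cases he0 : e = 0
  · subst he0
    exact ⟨he, 0, zero_mem _, add_zero _⟩
  obtain ⟨n, hn⟩ := exists_sub_twoPrimeAtom_mem he he0
  have hquot : ∀ x ∈ (fun s => s - d - twoPrimeAtom p n) '' S,
      x ∈ AddSubmonoid.closure {q | ∃ n, q = twoPrimeAtom p n} := by
    rintro _ ⟨s, hs, rfl⟩
    obtain ⟨r, hr, hsr⟩ := hediv s hs
    have : s - d - twoPrimeAtom p n = e - twoPrimeAtom p n + r := by rw [hsr]; ring
    simpa only [this] using add_mem hn hr
  obtain ⟨L, hL⟩ := exists_subset_twoPrimeTrunc (hfin.image _) hquot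
  obtain ⟨m, hm, H⟩ := exists_twoPrimeAtom_sub_mem_trunc hp hmono N (L + n) n (by omega)
  have hdm : ∀ s ∈ S, s - d - twoPrimeAtom p m ∈ twoPrimeTrunc p (N + 1) := fun s hs =>
    H _ (hd s hs) (twoPrimeTrunc_mono (by omega) (hL _ ⟨s, hs, rfl⟩))
  refine absurd ?_ (hmin (d + twoPrimeAtom p m)
    ⟨add_mem hdT (twoPrimeAtom_mem_trunc hm), fun s hs => by
      simpa only [sub_add_eq_sub_sub] using hdm s hs⟩)
  change f (d + twoPrimeAtom p m) < f d
  obtain ⟨u, hu⟩ := exists_twoPrimeDenom_mul_eq hp (hd s₀ hs₀)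
  obtain ⟨v, hv⟩ := exists_twoPrimeDenom_mul_eq hp (hdm s₀ hs₀)
  simp only [f, sub_add_eq_sub_sub, hu, hv, Nat.floor_natCast]
  have hD : (0 : ℚ) < twoPrimeDenom p (N + 1) := by exact_mod_cast twoPrimeDenom_pos hp (N + 1)
  have hpos := mul_pos hD (twoPrimeAtom_pos hp m)
  rw [mul_sub, hu] at hv
  exact_mod_cast (by linarith : (v : ℚ) < u)
end
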